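/- arXiv:1208.3568 — 3 statements merged into one kernel-verified Lean document; each statement's English description precedes it below -/
import Mathlib

section
/- For all δ > 0 and every integer t ≥ 3 there exists m₀ = m₀(δ,t) such that every δ-expander G on m ≥ m₀ vertices satisfies at least one of: (1) G has t vertices v_1,…,v_t each of degree at least (log m)⁴; (2) setting γ = δ/(5·(log log m)²), G contains t pairwise disjoint vertex sets S_1,…,S_t such that each induced subgraph G[S_i] is a γ-expanding ball, m^{1/5} ≤ |S_i| ≤ m^{1/4}, and every vertex of G[S_i] has degree at most (log m)⁴ in G[S_i]. -/
open Real

/-- Edge density `d(G) = |E(G)|/|V(G)|`. -/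
noncomputable def density {V : Type*} (G : SimpleGraph V) : ℝ :=
  G.edgeSet.ncard / Nat.card V

/-- External neighborhood `N(S)`: vertices outside `S` adjacent to some vertex of `S`. -/
def nbhd {V : Type*} (G : SimpleGraph V) (S : Set V) : Set V :=
  {v | v ∉ S ∧ ∃ u ∈ S, G.Adj u v}

/-- `G` contains a `K_t`-minor (branch sets are disjoint, nonempty, connected,
pairwise joined by an edge). -/
def HasKtMinor {V : Type*} (G : SimpleGraph V) (t : ℕ) : Prop :=
  ∃ P : Fin t → Set V,
    (∀ i, (P i).Nonempty) ∧
    (Pairwise (Function.onFun Disjoint P)) ∧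
    (∀ i, (G.induce (P i)).Connected) ∧
    (∀ i j : Fin t, i < j → ∃ u ∈ P i, ∃ v ∈ P j, G.Adj u v)

/-- `G` contains a `K_t`-minor of order at most `k`. -/
def HasKtMinorOfOrder {V : Type*} (G : SimpleGraph V) (t : ℕ) (k : ℝ) : Prop :=
  ∃ P : Fin t → Set V,
    (∀ i, (P i).Nonempty) ∧
    (Pairwise (Function.onFun Disjoint P)) ∧
    (∀ i, (G.induce (P i)).Connected) ∧
    (∀ i j : Fin t, i < j → ∃ u ∈ P i, ∃ v ∈ P j, G.Adj u v) ∧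
    ((⋃ i, P i).ncard : ℝ) ≤ k

/-- `c(t)`: the least `c` such that every graph of density at least `c` has a `K_t`-minor. -/
noncomputable def minorThreshold (t : ℕ) : ℝ :=
  sInf {c : ℝ | ∀ (n : ℕ) (G : SimpleGraph (Fin n)), density G ≥ c → HasKtMinor G t}

/-- `δ`-expander. -/
def IsDeltaExpander {V : Type*} (G : SimpleGraph V) (δ : ℝ) : Prop :=
  ∀ d : ℕ, (d : ℝ) ≤ logb 2 (logb 2 (Nat.card V)) - 1 →
    ∀ S : Set V, (S.ncard : ℝ) ≤ (Nat.card V : ℝ) / (2 : ℝ) ^ (2 ^ d : ℕ) →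
      ((nbhd G S).ncard : ℝ) ≥
        δ * 2 ^ d / (logb 2 (Nat.card V) * (logb 2 (logb 2 (Nat.card V))) ^ 2) * S.ncard

/-- `(δ, n)`-expander. -/
def IsDeltaNExpander {V : Type*} (G : SimpleGraph V) (δ : ℝ) (n : ℕ) : Prop :=
  ∀ d : ℕ, (d : ℝ) ≤ logb 2 (logb 2 (Nat.card V)) - 1 →
    ∀ S : Set V, (S.ncard : ℝ) ≤ (Nat.card V : ℝ) / (2 : ℝ) ^ (2 ^ d : ℕ) →
      ((nbhd G S).ncard : ℝ) ≥ δ * 2 ^ d / logb 2 n * S.ncard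

/-- `B_k(v)`: ball of radius `k` around the vertex `v`. -/
def gball {V : Type*} (G : SimpleGraph V) (v : V) (k : ℕ) : Set V :=
  {u | ∃ p : G.Walk v u, p.length ≤ k}

/-- `B_k(U)`: ball of radius `k` around the vertex set `U`. -/
def gballSet {V : Type*} (G : SimpleGraph V) (U : Set V) (k : ℕ) : Set V :=
  {v | ∃ u ∈ U, ∃ p : G.Walk u v, p.length ≤ k}

/-- A graph `H` is a `γ`-expanding ball: it is covered by a ball `B_k(v)` all of whose
intermediate balls expand by a factor `1 + γ`. -/
def GraphIsExpandingBall {V : Type*} (H : SimpleGraph V) (γ : ℝ) : Prop :=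
  ∃ (v : V) (k : ℕ), gball H v k = Set.univ ∧
    ∀ i : ℕ, 1 ≤ i → i + 1 ≤ k →
      ((gball H v (i + 1)).ncard : ℝ) ≥ (1 + γ) * (gball H v i).ncard

/-- The ball of radius `k` around `v` in the subgraph of `G` induced on `W` (together with `v`),
as a set of vertices of `G`. -/
def ballWithin {V : Type*} (G : SimpleGraph V) (W : Set V) (v : V) : ℕ → Set V
  | 0 => {v}
  | k + 1 => ballWithin G W v k ∪ (nbhd G (ballWithin G W v k) ∩ W)

section Balls

variable {V : Type*} {G : SimpleGraph V} {W : Set V} {v : V}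

theorem ballWithin_mono : Monotone (ballWithin G W v) :=
  monotone_nat_of_le_succ fun _ => Set.subset_union_left

theorem mem_ballWithin_self (k : ℕ) : v ∈ ballWithin G W v k :=
  ballWithin_mono (Nat.zero_le k) rfl

theorem ballWithin_subset (hv : v ∈ W) : ∀ k, ballWithin G W v k ⊆ W
  | 0 => Set.singleton_subset_iff.2 hv
  | k + 1 => Set.union_subset (ballWithin_subset hv k) Set.inter_subset_right

theorem gball_zero (G : SimpleGraph V) (v : V) : gball G v 0 = {v} := by
  ext u
  constructor
  · rintro ⟨p, hp⟩
    exact (SimpleGraph.Walk.eq_of_length_eq_zero (Nat.le_zero.1 hp)).symm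
  · rintro rfl
    exact ⟨.nil, le_rfl⟩

theorem gball_succ (G : SimpleGraph V) (v : V) (k : ℕ) :
    gball G v (k + 1) = gball G v k ∪ nbhd G (gball G v k) := by
  ext u
  constructor
  · rintro ⟨p, hp⟩
    by_cases hu : u ∈ gball G v k
    · exact Or.inl hu
    refine Or.inr ⟨hu, ?_⟩
    have hnil : ¬ p.Nil := fun h => hu ⟨p, by simp [SimpleGraph.Walk.length_eq_zero_iff.2 h]⟩
    refine ⟨p.penultimate, ⟨p.dropLast, ?_⟩, p.adj_penultimate hnil⟩
    have := p.length_dropLast_add_one hnil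
    omega
  · rintro (⟨p, hp⟩ | ⟨-, w, ⟨p, hp⟩, hwu⟩)
    · exact ⟨p, hp.trans (Nat.le_succ k)⟩
    · exact ⟨p.concat hwu, by simpa using hp⟩

/-- Balls of radius at most `k` inside the graph induced on a ball of radius `k` are the original
balls. -/
theorem image_gball_induce_ballWithin (k : ℕ) {i : ℕ} (hi : i ≤ k) :
    Subtype.val '' gball (G.induce (ballWithin G W v k)) ⟨v, mem_ballWithin_self k⟩ i =
      ballWithin G W v i := by
  induction i with
  | zero => simp [gball_zero, ballWithin]
  | succ i ih =>
    specialize ih (by omega)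
    rw [gball_succ, Set.image_union, ih]
    ext u
    constructor
    · rintro (hu | ⟨⟨u, huk⟩, ⟨hu, ⟨w, hwk⟩, hw, hwu⟩, rfl⟩)
      · exact Or.inl hu
      · have hu' : u ∉ ballWithin G W v i := by
          rw [← ih]
          rintro ⟨⟨u', hu'k⟩, hu', rfl⟩
          exact hu hu'
        have hw' : w ∈ ballWithin G W v i := ih ▸ ⟨_, hw, rfl⟩
        refine Or.inr ⟨⟨hu', w, hw', hwu⟩, ?_⟩
        have hmem : ∀ j, u ∈ ballWithin G W v j → u = v ∨ u ∈ W := by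
          intro j
          induction j with
          | zero => exact Or.inl
          | succ j ihj => exact fun h => h.elim ihj fun h => Or.inr h.2
        refine (hmem k huk).resolve_left ?_
        rintro rfl
        exact hu' (mem_ballWithin_self i)
    · rintro (hu | hu)
      · exact Or.inl hu
      · have huk : u ∈ ballWithin G W v k := ballWithin_mono hi (Or.inr hu)
        obtain ⟨⟨hu, w, hw, hwu⟩, -⟩ := hu
        refine Or.inr ⟨⟨u, huk⟩, ⟨fun h => hu (ih ▸ ⟨_, h, rfl⟩), ?_⟩, rfl⟩
        rw [← ih] at hw
        obtain ⟨w, hw, rfl⟩ := hw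
        exact ⟨w, hw, hwu⟩

theorem graphIsExpandingBall_induce_ballWithin {γ : ℝ} {k : ℕ}
    (h : ∀ i < k, (1 + γ) * ((ballWithin G W v i).ncard : ℝ) ≤ (ballWithin G W v (i + 1)).ncard) :
    GraphIsExpandingBall (G.induce (ballWithin G W v k)) γ := by
  have hcard : ∀ i ≤ k,
      (gball (G.induce (ballWithin G W v k)) ⟨v, mem_ballWithin_self k⟩ i).ncard =
        (ballWithin G W v i).ncard := fun i hi => by
    rw [← image_gball_induce_ballWithin k hi, Set.ncard_image_of_injective _ Subtype.val_injective]
  refine ⟨⟨v, mem_ballWithin_self k⟩, k, ?_, fun i _ hi => ?_⟩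
  · apply Subtype.val_injective.image_injective
    rw [image_gball_induce_ballWithin k le_rfl, Set.image_univ, Subtype.range_coe]
  · rw [hcard _ hi, hcard _ (by omega)]
    exact h i hi

theorem ncard_ballWithin_succ_le [Finite V] (hv : v ∈ W) {D : ℝ}
    (hD : ∀ x ∈ W, ((G.neighborSet x).ncard : ℝ) ≤ D) (k : ℕ) :
    ((ballWithin G W v (k + 1)).ncard : ℝ) ≤ (D + 1) * (ballWithin G W v k).ncard := by
  classical
  have := Fintype.ofFinite V
  set B := ballWithin G W v k with hB
  have hN : nbhd G B ∩ W ⊆ ↑(B.toFinset.biUnion fun x => (G.neighborSet x).toFinset) := by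
    rintro u ⟨⟨-, w, hw, hwu⟩, -⟩
    simpa using ⟨w, hw, hwu⟩
  have hN' : ((nbhd G B ∩ W).ncard : ℝ) ≤ B.ncard * D := by
    calc ((nbhd G B ∩ W).ncard : ℝ)
        ≤ (B.toFinset.biUnion fun x => (G.neighborSet x).toFinset).card := by
          rw [← Set.ncard_coe_finset]
          exact_mod_cast Set.ncard_le_ncard hN (Set.toFinite _)
      _ ≤ ∑ x ∈ B.toFinset, ((G.neighborSet x).toFinset.card : ℝ) := by
          exact_mod_cast Finset.card_biUnion_le
      _ ≤ B.toFinset.card • D := by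
          refine Finset.sum_le_card_nsmul _ _ _ fun x hx => ?_
          rw [← Set.ncard_eq_toFinset_card']
          exact hD x (ballWithin_subset hv k (by simpa using hx))
      _ = B.ncard * D := by rw [nsmul_eq_mul, ← Set.ncard_eq_toFinset_card']
  have hU : ((ballWithin G W v (k + 1)).ncard : ℝ) ≤ B.ncard + (nbhd G B ∩ W).ncard := by
    exact_mod_cast Set.ncard_union_le _ _
  linarith

/-- If large sets expand even after deleting `X`, then outside some superset `Y` of `X` there is a
vertex all of whose small balls expand. -/
theorem exists_forall_ballWithin_expands [Finite V] (G : SimpleGraph V) (X : Set V)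
    {γ q h r : ℝ} (hqh : h + q ≤ r) (hh : 0 ≤ h) (hq : 0 ≤ q)
    (hexp : ∀ U : Set V, h < U.ncard → (U.ncard : ℝ) ≤ r →
      γ * U.ncard + X.ncard < (nbhd G U).ncard)
    (hcard : X.ncard + h < Nat.card V) :
    ∃ W : Set V, Disjoint W X ∧ ∃ v ∈ W, ∀ i, ((ballWithin G W v i).ncard : ℝ) < q →
      (1 + γ) * ((ballWithin G W v i).ncard : ℝ) ≤ (ballWithin G W v (i + 1)).ncard := by
  let P : Set (Set V) := {U | Disjoint U X ∧ (U.ncard : ℝ) ≤ r ∧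
    ((nbhd G U \ X).ncard : ℝ) ≤ γ * U.ncard}
  have hempty : ∅ ∈ P := by
    refine ⟨Set.empty_disjoint X, by simp; linarith, ?_⟩
    have : nbhd G ∅ = ∅ := by ext; simp [nbhd]
    simp [this]
  obtain ⟨U, ⟨hUX, hUr, hUγ⟩, hmax⟩ :=
    Set.exists_max_image P Set.ncard (Set.toFinite P) ⟨∅, hempty⟩
  have hUh : (U.ncard : ℝ) ≤ h := by
    by_contra! hlt
    have h1 := hexp U hlt hUr
    have h2 : ((nbhd G U).ncard : ℝ) ≤ (nbhd G U \ X).ncard + X.ncard := by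
      exact_mod_cast Set.ncard_le_ncard_sdiff_add_ncard _ _ (Set.toFinite _)
    linarith
  obtain ⟨v, hv⟩ : ∃ v, v ∉ X ∪ U := by
    by_contra! hall
    have h1 := Set.ncard_union_le X U
    rw [Set.eq_univ_of_forall hall, Set.ncard_univ] at h1
    have h2 : (Nat.card V : ℝ) ≤ X.ncard + U.ncard := by exact_mod_cast h1
    linarith
  refine ⟨(X ∪ U)ᶜ, disjoint_compl_left.mono_right Set.subset_union_left, v, hv, fun i hi => ?_⟩
  by_contra! hlt
  set B := ballWithin G (X ∪ U)ᶜ v i with hB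
  have hBW : B ⊆ (X ∪ U)ᶜ := ballWithin_subset hv i
  have hdisj : Disjoint B (nbhd G B ∩ (X ∪ U)ᶜ) :=
    Set.disjoint_left.2 fun x hx hx' => hx'.1.1 hx
  have hsucc : ((ballWithin G (X ∪ U)ᶜ v (i + 1)).ncard : ℝ) =
      B.ncard + (nbhd G B ∩ (X ∪ U)ᶜ).ncard := by
    exact_mod_cast Set.ncard_union_eq hdisj (Set.toFinite _) (Set.toFinite _)
  have hUB : Disjoint U B := (disjoint_compl_left.mono hBW Set.subset_union_right).symm
  have hUBcard : ((U ∪ B).ncard : ℝ) = U.ncard + B.ncard := by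
    exact_mod_cast Set.ncard_union_eq hUB (Set.toFinite _) (Set.toFinite _)
  have hmem : U ∪ B ∈ P := by
    refine ⟨hUX.union_left (disjoint_compl_left.mono hBW Set.subset_union_left), ?_, ?_⟩
    · linarith
    · have hsub : nbhd G (U ∪ B) \ X ⊆ (nbhd G U \ X) ∪ (nbhd G B ∩ (X ∪ U)ᶜ) := by
        rintro u ⟨⟨hu, w, hw | hw, hwu⟩, huX⟩
        · exact Or.inl ⟨⟨fun h => hu (Or.inl h), w, hw, hwu⟩, huX⟩
        · exact Or.inr ⟨⟨fun h => hu (Or.inr h), w, hw, hwu⟩,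
            fun h => h.elim huX fun h => hu (Or.inl h)⟩
      have hle : ((nbhd G (U ∪ B) \ X).ncard : ℝ) ≤
          (nbhd G U \ X).ncard + (nbhd G B ∩ (X ∪ U)ᶜ).ncard := by
        exact_mod_cast (Set.ncard_le_ncard hsub (Set.toFinite _)).trans (Set.ncard_union_le _ _)
      rw [hUBcard]
      linarith
  have h1 : ((U ∪ B).ncard : ℝ) ≤ U.ncard := by exact_mod_cast hmax _ hmem
  have h2 : 0 < B.ncard := (Set.ncard_pos (Set.toFinite _)).2 ⟨v, mem_ballWithin_self i⟩
  have h3 : (0 : ℝ) < B.ncard := by exact_mod_cast h2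
  linarith

/-- Under the hypotheses of `exists_forall_ballWithin_expands`, if all degrees outside `X` are at
most `D`, there is an expanding ball avoiding `X` whose size lies in `[q, (D + 1) * q]`. -/
theorem exists_expandingBall_disjoint [Finite V] (G : SimpleGraph V) (X : Set V)
    {γ q h r D : ℝ} (hγ : 0 < γ) (hqh : h + q ≤ r) (hh : 0 ≤ h) (hq : 1 < q)
    (hexp : ∀ U : Set V, h < U.ncard → (U.ncard : ℝ) ≤ r →
      γ * U.ncard + X.ncard < (nbhd G U).ncard)
    (hcard : X.ncard + h < Nat.card V)
    (hD : ∀ x ∉ X, ((G.neighborSet x).ncard : ℝ) ≤ D) :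
    ∃ S : Set V, Disjoint S X ∧ GraphIsExpandingBall (G.induce S) γ ∧ q ≤ S.ncard ∧
      (S.ncard : ℝ) ≤ (D + 1) * q := by
  obtain ⟨W, hWX, v, hv, hW⟩ :=
    exists_forall_ballWithin_expands G X hqh hh (by linarith) hexp hcard
  have hex : ∃ k, q ≤ ((ballWithin G W v k).ncard : ℝ) := by
    by_contra! hall
    have hpow : ∀ k, (1 + γ) ^ k ≤ ((ballWithin G W v k).ncard : ℝ) := by
      intro k
      induction k with
      | zero => simp [ballWithin]
      | succ k ih =>
        rw [pow_succ']
        exact (mul_le_mul_of_nonneg_left ih (by linarith)).trans (hW k (hall k))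
    obtain ⟨k, hk⟩ := pow_unbounded_of_one_lt q (by linarith : 1 < 1 + γ)
    linarith [hpow k, hall k]
  classical
  have hmin : ∀ i < Nat.find hex, ((ballWithin G W v i).ncard : ℝ) < q :=
    fun i hi => not_le.1 (Nat.find_min hex hi)
  have hspec := Nat.find_spec hex
  refine ⟨ballWithin G W v (Nat.find hex), hWX.mono_left (ballWithin_subset hv _),
    graphIsExpandingBall_induce_ballWithin fun i hi => hW i (hmin i hi), hspec, ?_⟩
  have hDW : ∀ x ∈ W, ((G.neighborSet x).ncard : ℝ) ≤ D :=
    fun x hx => hD x (Set.disjoint_left.1 hWX hx)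
  have hD0 : 0 ≤ D := (Nat.cast_nonneg _).trans (hDW v hv)
  rcases hk : Nat.find hex with _ | k
  · rw [hk] at hspec
    simp only [ballWithin, Set.ncard_singleton, Nat.cast_one] at hspec
    linarith
  · exact (ncard_ballWithin_succ_le hv hDW k).trans
      (mul_le_mul_of_nonneg_left (hmin k (by omega)).le (by linarith))

/-- Greedy choice of pairwise disjoint sets of bounded size with a prescribed property. -/
theorem exists_pairwise_disjoint_of_forall_exists_disjoint [Finite V] {P : Set V → Prop}
    {Z : Set V} {z b N : ℝ} (hZ : (Z.ncard : ℝ) ≤ z) (hb : 0 ≤ b)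
    (hP : ∀ S, P S → (S.ncard : ℝ) ≤ b)
    (hex : ∀ X : Set V, Z ⊆ X → (X.ncard : ℝ) ≤ N → ∃ S, Disjoint S X ∧ P S) (t : ℕ)
    (hN : z + t * b ≤ N) :
    ∃ S : Fin t → Set V, Pairwise (Function.onFun Disjoint S) ∧ ∀ i, Disjoint (S i) Z ∧ P (S i) := by
  induction t generalizing Z z with
  | zero => exact ⟨fun _ => ∅, fun i => i.elim0, fun i => i.elim0⟩
  | succ t ih =>
    push_cast at hN
    have htb : 0 ≤ t * b := by positivity
    obtain ⟨S₀, hS₀, hPS₀⟩ := hex Z subset_rfl (by linarith)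
    have hcard : ((Z ∪ S₀).ncard : ℝ) ≤ Z.ncard + S₀.ncard := by
      exact_mod_cast Set.ncard_union_le _ _
    obtain ⟨S, hS, hPS⟩ := ih (Z := Z ∪ S₀) (z := z + b) (by linarith [hP S₀ hPS₀])
      (fun X hX => hex X (Set.subset_union_left.trans hX)) (by linarith)
    refine ⟨Fin.cons S₀ S, ?_, ?_⟩
    · intro i j hij
      cases i using Fin.cases <;> cases j using Fin.cases
      · exact absurd rfl hij
      · simpa [Function.onFun] using ((hPS _).1.mono_right Set.subset_union_right).symm
      · simpa [Function.onFun] using (hPS _).1.mono_right Set.subset_union_right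
      · simpa [Function.onFun] using hS fun h => hij (congrArg Fin.succ h)
    · intro i
      cases i using Fin.cases
      · simpa using ⟨hS₀, hPS₀⟩
      · simpa using ⟨(hPS _).1.mono_right Set.subset_union_left, (hPS _).2⟩

/-- In a `δ`-expander, sets of size at most the square root of the order expand well. -/
theorem IsDeltaExpander.le_ncard_nbhd {δ : ℝ} (hG : IsDeltaExpander G δ) (hδ : 0 < δ)
    (hm : 1 ≤ logb 2 (logb 2 (Nat.card V))) (hL : 0 < logb 2 (Nat.card V))
    (hm0 : 0 < Nat.card V) {S : Set V}
    (hS : (S.ncard : ℝ) ≤ (Nat.card V : ℝ) ^ ((1 : ℝ) / 2)) :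
    δ / (4 * logb 2 (logb 2 (Nat.card V)) ^ 2) * S.ncard ≤ (nbhd G S).ncard := by
  set m : ℝ := (Nat.card V : ℝ) with hmdef
  have hmpos : 0 < m := Nat.cast_pos.2 hm0
  set L := logb 2 m with hLdef
  set l := logb 2 L with hl
  have hLl : (2 : ℝ) ^ l = L := Real.rpow_logb (by norm_num) (by norm_num) hL
  have hmL : (2 : ℝ) ^ L = m := Real.rpow_logb (by norm_num) (by norm_num) hmpos
  have hd := Nat.floor_le (by linarith : 0 ≤ l - 1)
  have hd' := Nat.lt_floor_add_one (l - 1)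
  set d := ⌊l - 1⌋₊
  have hupper : (2 : ℝ) ^ d ≤ L / 2 := by
    rw [← Real.rpow_natCast, ← hLl]
    calc (2 : ℝ) ^ (d : ℝ) ≤ 2 ^ (l - 1) := Real.rpow_le_rpow_of_exponent_le (by norm_num) hd
      _ = 2 ^ l / 2 := by rw [Real.rpow_sub (by norm_num), Real.rpow_one]
  have hlower : L / 4 ≤ (2 : ℝ) ^ d := by
    rw [← Real.rpow_natCast, ← hLl]
    calc (2 : ℝ) ^ l / 4 = 2 ^ (l - 2) := by
          rw [Real.rpow_sub (by norm_num)]; norm_num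
      _ ≤ 2 ^ (d : ℝ) := Real.rpow_le_rpow_of_exponent_le (by norm_num) (by linarith)
  have hsqrt : (2 : ℝ) ^ (2 ^ d : ℕ) ≤ m ^ ((1 : ℝ) / 2) := by
    rw [← Real.rpow_natCast, ← hmL, ← Real.rpow_mul (by norm_num)]
    refine Real.rpow_le_rpow_of_exponent_le (by norm_num) ?_
    push_cast
    linarith
  have hmm : m ^ ((1 : ℝ) / 2) * m ^ ((1 : ℝ) / 2) = m := by
    rw [← Real.rpow_add hmpos]; norm_num
  have hsmall : (S.ncard : ℝ) ≤ m / (2 : ℝ) ^ (2 ^ d : ℕ) := by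
    rw [le_div_iff₀ (by positivity)]
    calc (S.ncard : ℝ) * (2 : ℝ) ^ (2 ^ d : ℕ) ≤ m ^ ((1 : ℝ) / 2) * m ^ ((1 : ℝ) / 2) := by gcongr
      _ = m := hmm
  refine le_trans ?_ (hG d hd S hsmall)
  gcongr ?_ * _
  have hl0 : 0 < l := by linarith
  rw [div_le_div_iff₀ (by positivity) (by positivity)]
  nlinarith [mul_le_mul_of_nonneg_left hlower (by positivity : 0 ≤ δ * l ^ 2)]

end Balls

section Asymptotics

open Filter Asymptotics

theorem eventually_mul_logb_pow_le_rpow (C : ℝ) (n : ℕ) {s : ℝ} (hs : 0 < s) :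
    ∀ᶠ x : ℝ in atTop, C * logb 2 x ^ n ≤ x ^ s := by
  have h := (isLittleO_log_rpow_rpow_atTop (n : ℝ) hs).const_mul_left (C / log 2 ^ n)
  filter_upwards [h.bound one_pos, eventually_gt_atTop 0] with x hx hx0
  rw [one_mul, Real.norm_of_nonneg (rpow_nonneg hx0.le s), rpow_natCast] at hx
  calc C * logb 2 x ^ n = C / log 2 ^ n * log x ^ n := by rw [logb, div_pow]; ring
    _ ≤ x ^ s := (le_abs_self _).trans hx

/-- All size comparisons between powers of `m` and of its logarithm used for `stmt_6`. -/
theorem eventually_size_bounds {δ : ℝ} (hδ : 0 < δ) (t : ℕ) :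
    ∀ᶠ m : ℝ in atTop, 1 < m ∧ 0 < logb 2 m ∧ 1 ≤ logb 2 (logb 2 m) ∧
      m ^ ((1 : ℝ) / 3) + m ^ ((1 : ℝ) / 5) ≤ m ^ ((1 : ℝ) / 2) ∧
      (logb 2 m ^ 4 + 1) * m ^ ((1 : ℝ) / 5) ≤ m ^ ((1 : ℝ) / 4) ∧
      t + t * m ^ ((1 : ℝ) / 4) + m ^ ((1 : ℝ) / 3) < m ∧
      t + t * m ^ ((1 : ℝ) / 4) ≤
        δ / (20 * logb 2 (logb 2 m) ^ 2) * m ^ ((1 : ℝ) / 3) := by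
  have hL : Tendsto (logb 2) atTop atTop := tendsto_logb_atTop (by norm_num)
  filter_upwards [eventually_gt_atTop 1, hL.eventually_ge_atTop 1,
    (hL.comp hL).eventually_ge_atTop 1,
    eventually_mul_logb_pow_le_rpow 2 0 (by norm_num : (0 : ℝ) < 1 / 6),
    eventually_mul_logb_pow_le_rpow 2 4 (by norm_num : (0 : ℝ) < 1 / 20),
    eventually_mul_logb_pow_le_rpow (2 * t) 0 (by norm_num : (0 : ℝ) < 1 / 4),
    eventually_mul_logb_pow_le_rpow 3 0 (by norm_num : (0 : ℝ) < 1 / 2),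
    eventually_mul_logb_pow_le_rpow (40 * t / δ) 2 (by norm_num : (0 : ℝ) < 1 / 12)]
    with m hm hL1 hl1 h6 h20 h4 h2 h12
  simp only [pow_zero, mul_one, Function.comp_apply] at h6 h4 h2 hl1
  have hm0 : 0 < m := by linarith
  have hmul : ∀ a b : ℝ, m ^ a * m ^ b = m ^ (a + b) := fun a b => (rpow_add hm0 a b).symm
  have hle : ∀ {a b : ℝ}, a ≤ b → m ^ a ≤ m ^ b := rpow_le_rpow_of_exponent_le hm.le
  have hpos : ∀ a : ℝ, 0 < m ^ a := fun a => rpow_pos_of_pos hm0 a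
  have e1 : m ^ ((1 : ℝ) / 6) * m ^ ((1 : ℝ) / 3) = m ^ ((1 : ℝ) / 2) := by rw [hmul]; norm_num
  have e2 : m ^ ((1 : ℝ) / 20) * m ^ ((1 : ℝ) / 5) = m ^ ((1 : ℝ) / 4) := by rw [hmul]; norm_num
  have e3 : m ^ ((1 : ℝ) / 4) * m ^ ((1 : ℝ) / 4) = m ^ ((1 : ℝ) / 2) := by rw [hmul]; norm_num
  have e4 : m ^ ((1 : ℝ) / 2) * m ^ ((1 : ℝ) / 2) = m := by rw [hmul]; norm_num
  have e5 : m ^ ((1 : ℝ) / 12) * m ^ ((1 : ℝ) / 4) = m ^ ((1 : ℝ) / 3) := by rw [hmul]; norm_num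
  have l53 : m ^ ((1 : ℝ) / 5) ≤ m ^ ((1 : ℝ) / 3) := hle (by norm_num)
  have l32 : m ^ ((1 : ℝ) / 3) ≤ m ^ ((1 : ℝ) / 2) := hle (by norm_num)
  have l4 : 1 ≤ m ^ ((1 : ℝ) / 4) := one_le_rpow hm.le (by norm_num)
  have ht : (t : ℝ) + t * m ^ ((1 : ℝ) / 4) ≤ 2 * t * m ^ ((1 : ℝ) / 4) := by
    nlinarith [mul_le_mul_of_nonneg_left l4 (Nat.cast_nonneg t : (0 : ℝ) ≤ t)]
  refine ⟨hm, by linarith, hl1, ?_, ?_, ?_, ?_⟩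
  · nlinarith [mul_le_mul_of_nonneg_right h6 (hpos (1 / 3)).le]
  · rw [← e2]
    refine mul_le_mul_of_nonneg_right ?_ (hpos _).le
    linarith [one_le_pow₀ hL1 (n := 4)]
  · nlinarith [mul_le_mul_of_nonneg_right h4 (hpos (1 / 4)).le,
      mul_le_mul_of_nonneg_right h2 (hpos (1 / 2)).le, hpos (1 / 2)]
  · have hlL : logb 2 (logb 2 m) ≤ logb 2 m := by
      have hlt : logb 2 m < 2 ^ logb 2 m := by
        have := one_add_mul_self_le_rpow_one_add (s := 1) (p := logb 2 m) (by norm_num) hL1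
        norm_num at this
        linarith
      exact ((logb_lt_iff_lt_rpow (by norm_num) (by linarith)).2 hlt).le
    have hl2 : logb 2 (logb 2 m) ^ 2 ≤ logb 2 m ^ 2 := by gcongr
    have hl0 : 0 < logb 2 (logb 2 m) := by linarith
    rw [div_mul_eq_mul_div, le_div_iff₀ (by positivity), ← e5]
    have h12' : 40 * t * logb 2 m ^ 2 ≤ δ * m ^ ((1 : ℝ) / 12) := by
      rw [div_mul_eq_mul_div, div_le_iff₀ hδ] at h12
      linarith
    calc (t + t * m ^ ((1 : ℝ) / 4)) * (20 * logb 2 (logb 2 m) ^ 2)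
        ≤ 2 * t * m ^ ((1 : ℝ) / 4) * (20 * logb 2 m ^ 2) := by gcongr
      _ = 40 * t * logb 2 m ^ 2 * m ^ ((1 : ℝ) / 4) := by ring
      _ ≤ δ * m ^ ((1 : ℝ) / 12) * m ^ ((1 : ℝ) / 4) := by gcongr
      _ = δ * (m ^ ((1 : ℝ) / 12) * m ^ ((1 : ℝ) / 4)) := by ring

end Asymptotics

/-- Claim 3.5: a large `δ`-expander either has `t` vertices of degree at least `(log m)⁴`,
or it has `t` disjoint sets inducing `γ`-expanding balls of polynomial size with all
degrees at most `(log m)⁴`. -/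
theorem stmt_6 :
    ∀ δ : ℝ, 0 < δ → ∀ t : ℕ, 3 ≤ t → ∃ m₀ : ℕ,
      ∀ m : ℕ, m₀ ≤ m → ∀ G : SimpleGraph (Fin m), IsDeltaExpander G δ →
        (∃ v : Fin t → Fin m, Function.Injective v ∧
            ∀ i, ((G.neighborSet (v i)).ncard : ℝ) ≥ (logb 2 m) ^ 4) ∨
        (∃ S : Fin t → Set (Fin m),
            (Pairwise (Function.onFun Disjoint S)) ∧
            ∀ i, GraphIsExpandingBall (G.induce (S i)) (δ / (5 * (logb 2 (logb 2 m)) ^ 2)) ∧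
              (m : ℝ) ^ ((1 : ℝ) / 5) ≤ ((S i).ncard : ℝ) ∧
              ((S i).ncard : ℝ) ≤ (m : ℝ) ^ ((1 : ℝ) / 4) ∧
              ∀ x : (S i), (((G.induce (S i)).neighborSet x).ncard : ℝ) ≤ (logb 2 m) ^ 4) := by
  intro δ hδ t _
  obtain ⟨m₀, hm₀⟩ := Filter.eventually_atTop.1
    (tendsto_natCast_atTop_atTop.eventually (eventually_size_bounds hδ t))
  refine ⟨m₀, fun m hm G hG => ?_⟩
  obtain ⟨hm1, hL, hl, h3, h5, hlt, hX⟩ := hm₀ m hm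
  set l := logb 2 (logb 2 m) with hldef
  have hl0 : 0 < l := by linarith
  let Z : Set (Fin m) := {v | ((G.neighborSet v).ncard : ℝ) ≥ logb 2 m ^ 4}
  by_cases hZ : t ≤ Z.ncard
  · left
    obtain ⟨f⟩ : Nonempty (Fin t ↪ Z) := by
      rw [Function.Embedding.nonempty_iff_card_le, Fintype.card_fin]
      rwa [← Nat.card_coe_set_eq, Nat.card_eq_fintype_card] at hZ
    exact ⟨fun i => f i, Subtype.val_injective.comp f.injective, fun i => (f i).2⟩
  right
  have hZt : (Z.ncard : ℝ) ≤ t := by exact_mod_cast (not_le.1 hZ).le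
  have hexists : ∀ X : Set (Fin m), Z ⊆ X → (X.ncard : ℝ) ≤ t + t * (m : ℝ) ^ ((1 : ℝ) / 4) →
      ∃ S, Disjoint S X ∧ (GraphIsExpandingBall (G.induce S) (δ / (5 * l ^ 2)) ∧
        (m : ℝ) ^ ((1 : ℝ) / 5) ≤ S.ncard ∧ (S.ncard : ℝ) ≤ (m : ℝ) ^ ((1 : ℝ) / 4)) := by
    intro X hZX hXt
    have hXexp : ∀ U : Set (Fin m), (m : ℝ) ^ ((1 : ℝ) / 3) < U.ncard →
        (U.ncard : ℝ) ≤ (m : ℝ) ^ ((1 : ℝ) / 2) →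
        δ / (5 * l ^ 2) * U.ncard + X.ncard < (nbhd G U).ncard := by
      intro U hU hUr
      have hexp := hG.le_ncard_nbhd hδ (S := U) (by simpa using hl) (by simpa using hL)
        (by simpa using (by exact_mod_cast (zero_lt_one.trans hm1) : 0 < m)) (by simpa using hUr)
      simp only [Nat.card_eq_fintype_card, Fintype.card_fin] at hexp
      rw [← hldef] at hexp
      have hsplit : δ / (4 * l ^ 2) = δ / (5 * l ^ 2) + δ / (20 * l ^ 2) := by
        field_simp
        norm_num
      have hgain : δ / (20 * l ^ 2) * (m : ℝ) ^ ((1 : ℝ) / 3) < δ / (20 * l ^ 2) * U.ncard :=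
        mul_lt_mul_of_pos_left hU (by positivity)
      rw [hsplit, add_mul] at hexp
      linarith
    obtain ⟨S, hSX, hS, hq, hS4⟩ := exists_expandingBall_disjoint G X
      (γ := δ / (5 * l ^ 2)) (D := logb 2 m ^ 4) (by positivity) h3 (by positivity)
      (one_lt_rpow hm1 (by norm_num)) hXexp
      (by rw [Nat.card_eq_fintype_card, Fintype.card_fin]; linarith)
      (fun x hx => (not_le.1 fun h => hx (hZX h)).le)
    exact ⟨S, hSX, hS, hq, hS4.trans h5⟩
  obtain ⟨S, hdisj, hS⟩ := exists_pairwise_disjoint_of_forall_exists_disjoint hZt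
    (by positivity : 0 ≤ (m : ℝ) ^ ((1 : ℝ) / 4)) (fun S hS => hS.2.2) hexists t le_rfl
  refine ⟨S, hdisj, fun i => ⟨(hS i).2.1, (hS i).2.2.1, (hS i).2.2.2, fun x => ?_⟩⟩
  have hx : ((G.neighborSet (x : Fin m)).ncard : ℝ) < logb 2 m ^ 4 :=
    not_le.1 (Set.disjoint_left.1 (hS i).1 x.2)
  refine le_trans ?_ hx.le
  rw [← Set.ncard_image_of_injective _ Subtype.val_injective]
  have hsub : Subtype.val '' (G.induce (S i)).neighborSet x ⊆ G.neighborSet x := by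
    rintro _ ⟨y, hy, rfl⟩
    exact hy
  exact_mod_cast Set.ncard_le_ncard hsub (Set.toFinite _)
end

section
/- There is an absolute constant C > 0 such that for all δ > 0 and every integer t ≥ 3 there exists m₀ = m₀(δ,t) with the following property: if G is a δ-expander on m ≥ m₀ vertices that contains t vertices v_1,…,v_t each of degree at least (log m)⁴, then G contains a K_t-minor of order at most C·(t²/δ)·log m·(log log m)³. -/
open Real

/-- The sets obtained from `S` by repeatedly adding all outer neighbours that avoid `W`. -/
def growBall {V : Type*} (G : SimpleGraph V) (W S : Set V) : ℕ → Set V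
  | 0 => S
  | k + 1 => growBall G W S k ∪ (nbhd G (growBall G W S k) \ W)

lemma subset_growBall {V : Type*} (G : SimpleGraph V) (W S : Set V) (k : ℕ) :
    S ⊆ growBall G W S k := by
  induction k with
  | zero => exact subset_rfl
  | succ k ih => exact ih.trans Set.subset_union_left

/-- Every vertex of the `k`-th grown ball is joined to `S` by a connected set of at most `k + 1`
vertices that avoids `W`. -/
lemma exists_connected_of_mem_growBall {V : Type*} [Finite V] {G : SimpleGraph V} {W S : Set V}
    (hSW : Disjoint S W) {k : ℕ} {x : V} (hx : x ∈ growBall G W S k) :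
    ∃ Q : Set V, x ∈ Q ∧ (Q ∩ S).Nonempty ∧ Disjoint Q W ∧ (G.induce Q).Connected ∧
      Q.ncard ≤ k + 1 := by
  induction k generalizing x with
  | zero =>
    refine ⟨{x}, rfl, ⟨x, rfl, hx⟩, ?_, ?_, by simp⟩
    · exact Set.disjoint_singleton_left.2 (Set.disjoint_left.1 hSW hx)
    · exact ⟨SimpleGraph.Preconnected.of_subsingleton⟩
  | succ k ih =>
    rcases hx with hx | ⟨⟨-, u, hu, hux⟩, hxW⟩
    · obtain ⟨Q, h₁, h₂, h₃, h₄, h₅⟩ := ih hx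
      exact ⟨Q, h₁, h₂, h₃, h₄, by omega⟩
    · obtain ⟨Q, huQ, ⟨s, hsQ, hsS⟩, hQW, hQ, hcard⟩ := ih hu
      refine ⟨Q ∪ {x}, Or.inr rfl, ⟨s, Or.inl hsQ, hsS⟩, ?_, ?_, ?_⟩
      · exact Set.disjoint_union_left.2 ⟨hQW, Set.disjoint_singleton_left.2 hxW⟩
      · exact SimpleGraph.connected_induce_union hQ.preconnected
          SimpleGraph.Preconnected.of_subsingleton huQ rfl hux
      · have := Set.ncard_union_le Q {x}
        rw [Set.ncard_singleton] at this
        omega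

lemma exists_dyadic_scale {x L : ℝ} (hx : 1 ≤ x) (hxL : x ≤ L) (hL : 2 ≤ L) :
    ∃ d : ℕ, (d : ℝ) ≤ logb 2 L - 1 ∧ (2 : ℝ) ^ d ≤ x ∧ x ≤ 4 * 2 ^ d := by
  have key : ∀ d : ℕ, (2 : ℝ) ^ d ≤ L / 2 → (d : ℝ) ≤ logb 2 L - 1 := by
    intro d hd
    rw [le_sub_iff_add_le, Real.le_logb_iff_rpow_le one_lt_two (by linarith),
      Real.rpow_add two_pos, Real.rpow_natCast, Real.rpow_one]
    linarith
  rcases lt_or_ge x 2 with h | h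
  · exact ⟨0, key 0 (by norm_num; linarith), by simpa using hx, by norm_num; linarith⟩
  · obtain ⟨d, h₁, h₂⟩ := exists_nat_pow_near (x := x / 2) (by linarith) (one_lt_two (α := ℝ))
    refine ⟨d, key d (by linarith), by linarith, ?_⟩
    rw [pow_succ] at h₂
    linarith

lemma le_logb_two_one_add {γ : ℝ} (h₀ : 0 ≤ γ) (h₁ : γ ≤ 1) : γ ≤ logb 2 (1 + γ) := by
  rw [Real.le_logb_iff_rpow_le one_lt_two (by linarith)]
  have := rpow_one_add_le_one_add_mul_self (s := 1) (by norm_num) h₀ h₁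
  norm_num at this
  exact this

/-- One growth step in an expander shrinks `log (m / |S|)` by a constant factor, even when a small
set `W` is forbidden. -/
lemma IsDeltaExpander.logb_card_div_grow_le {V : Type*} [Finite V] {G : SimpleGraph V}
    {δ L l c : ℝ} (hG : IsDeltaExpander G δ) (hδ : 0 < δ) (hL : L = logb 2 (Nat.card V))
    (hl : l = logb 2 L) (hc : c = δ / (2 * L * l ^ 2)) (hL2 : 2 ≤ L) (hδl : δ ≤ 2 * l ^ 2)
    {W S : Set V} (hW : (W.ncard : ℝ) ≤ c * S.ncard) (hS : 0 < S.ncard)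
    (hhalf : (S.ncard : ℝ) ≤ Nat.card V / 2) :
    logb 2 (Nat.card V / (S ∪ (nbhd G S \ W)).ncard) ≤
      (1 - c / 4) * logb 2 (Nat.card V / S.ncard) := by
  have hs : (0 : ℝ) < S.ncard := by exact_mod_cast hS
  have hs1 : (1 : ℝ) ≤ S.ncard := by exact_mod_cast hS
  have hm : (0 : ℝ) < Nat.card V := by linarith
  have hl1 : 1 ≤ l := by
    rw [hl, Real.le_logb_iff_rpow_le one_lt_two (by linarith)]
    simpa using hL2
  have hcpos : 0 < c := by rw [hc]; positivity
  set x := logb 2 (Nat.card V / S.ncard) with hx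
  have hx1 : 1 ≤ x := by
    rw [hx, Real.le_logb_iff_rpow_le one_lt_two (by positivity), Real.rpow_one,
      le_div_iff₀ hs]
    linarith
  have hxL : x ≤ L := by
    rw [hx, hL]
    exact Real.logb_le_logb_of_le one_lt_two (by positivity) (div_le_self hm.le hs1)
  obtain ⟨d, hd, hdx, hxd⟩ := exists_dyadic_scale hx1 hxL hL2
  have hsize : (S.ncard : ℝ) ≤ (Nat.card V : ℝ) / (2 : ℝ) ^ (2 ^ d : ℕ) := by
    have h : (2 : ℝ) ^ (2 ^ d : ℕ) ≤ Nat.card V / S.ncard := by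
      have := (Real.le_logb_iff_rpow_le one_lt_two (by positivity)).1 hdx
      rw [← Real.rpow_natCast]
      exact_mod_cast this
    rw [le_div_iff₀ hs] at h
    rw [le_div_iff₀ (by positivity)]
    linarith
  have hexp := hG d (by rw [← hL]; exact hd) S hsize
  rw [← hL, ← hl] at hexp
  have hrate : δ * 2 ^ d / (L * l ^ 2) = 2 * (c * 2 ^ d) := by
    rw [hc]; field_simp
  rw [hrate] at hexp
  set γ := c * 2 ^ d with hγ
  have hγ0 : 0 < γ := by positivity
  have hcγ : c ≤ γ := le_mul_of_one_le_right hcpos.le (one_le_pow₀ one_le_two)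
  have hγ1 : γ ≤ 1 := by
    have h : γ ≤ c * L := mul_le_mul_of_nonneg_left (hdx.trans hxL) hcpos.le
    have h' : c * L = δ / (2 * l ^ 2) := by rw [hc]; field_simp
    rw [h'] at h
    exact h.trans ((div_le_one (by positivity)).2 hδl)
  have hunion : (1 + γ) * S.ncard ≤ ((S ∪ (nbhd G S \ W)).ncard : ℝ) := by
    have hdisj : Disjoint S (nbhd G S \ W) :=
      Set.disjoint_left.2 fun _ ha hb => hb.1.1 ha
    rw [Set.ncard_union_eq hdisj]
    have h₁ : (nbhd G S).ncard ≤ (nbhd G S \ W).ncard + W.ncard :=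
      Set.ncard_le_ncard_sdiff_add_ncard _ _
    have h₂ : ((nbhd G S).ncard : ℝ) ≤ (nbhd G S \ W).ncard + W.ncard := by exact_mod_cast h₁
    have h₃ : c * S.ncard ≤ γ * S.ncard := by gcongr
    push_cast
    linarith
  calc logb 2 (Nat.card V / (S ∪ (nbhd G S \ W)).ncard)
      ≤ logb 2 (Nat.card V / ((1 + γ) * S.ncard)) := by
        apply Real.logb_le_logb_of_le one_lt_two
        · have : 0 < ((S ∪ (nbhd G S \ W)).ncard : ℝ) := lt_of_lt_of_le (by positivity) hunion
          positivity
        · gcongr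
    _ = x - logb 2 (1 + γ) := by
        rw [hx, ← Real.logb_div (by positivity) (by positivity), div_div, mul_comm]
    _ ≤ x - γ := by linarith [le_logb_two_one_add hγ0.le hγ1]
    _ ≤ (1 - c / 4) * x := by
        have : c * x ≤ c * (4 * 2 ^ d) := by gcongr
        linarith

/-- Growing a large enough set away from a small set `W` covers more than half of an expander
after `O(log L / c)` steps. -/
lemma IsDeltaExpander.half_lt_ncard_growBall {V : Type*} [Finite V] {G : SimpleGraph V}
    {δ L l c : ℝ} (hG : IsDeltaExpander G δ) (hδ : 0 < δ) (hL : L = logb 2 (Nat.card V))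
    (hl : l = logb 2 L) (hc : c = δ / (2 * L * l ^ 2)) (hL2 : 2 ≤ L) (hδl : δ ≤ 2 * l ^ 2)
    {W S : Set V} (hW : (W.ncard : ℝ) ≤ c * S.ncard) (hS : 0 < S.ncard)
    {k : ℕ} (hk : 4 * Real.log L / c < k) :
    (Nat.card V : ℝ) / 2 < (growBall G W S k).ncard := by
  have hl1 : 1 ≤ l := by
    rw [hl, Real.le_logb_iff_rpow_le one_lt_two (by linarith)]
    simpa using hL2
  have hcpos : 0 < c := by rw [hc]; positivity
  have hc1 : c ≤ 1 := by
    rw [hc, div_le_one (by positivity)]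
    nlinarith [sq_nonneg l]
  have hsub : ∀ j, S.ncard ≤ (growBall G W S j).ncard := fun j =>
    Set.ncard_le_ncard (subset_growBall G W S j)
  have hm : (0 : ℝ) < Nat.card V := by
    have : S.ncard ≤ Nat.card V := Set.ncard_le_card S
    exact_mod_cast hS.trans_le this
  have hdecay : ∀ j, (Nat.card V : ℝ) / 2 < (growBall G W S j).ncard ∨
      logb 2 (Nat.card V / (growBall G W S j).ncard) ≤ (1 - c / 4) ^ j * L := by
    intro j
    induction j with
    | zero =>
      right
      have hs1 : (1 : ℝ) ≤ S.ncard := by exact_mod_cast hS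
      simp only [growBall, pow_zero, one_mul, hL]
      exact Real.logb_le_logb_of_le one_lt_two (by positivity) (div_le_self hm.le hs1)
    | succ j ih =>
      have hmono : (growBall G W S j).ncard ≤ (growBall G W S (j + 1)).ncard :=
        Set.ncard_le_ncard Set.subset_union_left
      have hmono' : ((growBall G W S j).ncard : ℝ) ≤ (growBall G W S (j + 1)).ncard := by
        exact_mod_cast hmono
      rcases lt_or_ge ((Nat.card V : ℝ) / 2) (growBall G W S j).ncard with h | h
      · exact Or.inl (h.trans_le hmono')
      · right
        have hsub' : (S.ncard : ℝ) ≤ (growBall G W S j).ncard := by exact_mod_cast hsub j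
        have hstep := hG.logb_card_div_grow_le hδ hL hl hc hL2 hδl (W := W)
          (S := growBall G W S j) (hW.trans (by gcongr)) (hS.trans_le (hsub j)) h
        refine hstep.trans ?_
        rw [pow_succ', mul_assoc]
        exact mul_le_mul_of_nonneg_left (ih.resolve_left h.not_gt) (by linarith)
  rcases hdecay k with h | h
  · exact h
  · have hpos : (0 : ℝ) < (growBall G W S k).ncard := by exact_mod_cast hS.trans_le (hsub k)
    have hlt : (1 - c / 4) ^ k * L < 1 := by
      have h₁ : (1 - c / 4) ^ k ≤ Real.exp (-(c / 4 * k)) := by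
        calc (1 - c / 4) ^ k ≤ Real.exp (-(c / 4)) ^ k :=
              pow_le_pow_left₀ (by linarith) (Real.one_sub_le_exp_neg _) k
          _ = Real.exp (-(c / 4 * k)) := by rw [← Real.exp_nat_mul]; congr 1; ring
      have h₂ : Real.log L < c / 4 * k := by
        rw [div_lt_iff₀ hcpos] at hk
        linarith
      calc (1 - c / 4) ^ k * L ≤ Real.exp (-(c / 4 * k)) * Real.exp (Real.log L) := by
            rw [Real.exp_log (by linarith)]; gcongr
        _ = Real.exp (Real.log L - c / 4 * k) := by rw [← Real.exp_add]; congr 1; ring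
        _ < 1 := Real.exp_lt_one_iff.2 (by linarith)
    have h' := h.trans_lt hlt
    rw [Real.logb_lt_iff_lt_rpow one_lt_two (by positivity), Real.rpow_one,
      div_lt_iff₀ hpos] at h'
    linarith

lemma Set.inter_nonempty_of_half_lt_ncard {V : Type*} [Finite V] {A B : Set V}
    (hA : (Nat.card V : ℝ) / 2 < A.ncard) (hB : (Nat.card V : ℝ) / 2 < B.ncard) :
    (A ∩ B).Nonempty := by
  by_contra h
  rw [Set.not_nonempty_iff_eq_empty, ← Set.disjoint_iff_inter_eq_empty] at h
  have h₁ := Set.ncard_union_eq h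
  have h₂ : (A ∪ B).ncard ≤ Nat.card V := Set.ncard_le_card _
  rw [h₁] at h₂
  have h₃ : (A.ncard : ℝ) + B.ncard ≤ Nat.card V := by exact_mod_cast h₂
  linarith

/-- In an expander, the neighbourhoods of two vertices of large degree are joined by a small
connected set that avoids a given small set `W`. -/
lemma IsDeltaExpander.exists_connector {V : Type*} [Finite V] {G : SimpleGraph V}
    {δ L l c w a : ℝ} (hG : IsDeltaExpander G δ) (hδ : 0 < δ) (hL : L = logb 2 (Nat.card V))
    (hl : l = logb 2 L) (hc : c = δ / (2 * L * l ^ 2)) (hL2 : 2 ≤ L) (hδl : δ ≤ 2 * l ^ 2)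
    {k : ℕ} (hk : 4 * Real.log L / c < k) (hwa : w < a) (hwc : w ≤ c * (a - w))
    {x y : V} (hx : a ≤ (G.neighborSet x).ncard) (hy : a ≤ (G.neighborSet y).ncard)
    {W : Set V} (hW : (W.ncard : ℝ) ≤ w) :
    ∃ Q : Set V, (∃ u ∈ Q, G.Adj x u) ∧ (∃ u ∈ Q, G.Adj y u) ∧ Disjoint Q W ∧
      (G.induce Q).Connected ∧ Q.ncard ≤ 2 * (k + 1) := by
  have hcpos : 0 ≤ c := by rw [hc]; positivity
  have hball : ∀ z : V, a ≤ (G.neighborSet z).ncard →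
      (Nat.card V : ℝ) / 2 < (growBall G W (G.neighborSet z \ W) k).ncard := by
    intro z hz
    have h₁ := Set.ncard_le_ncard_sdiff_add_ncard (G.neighborSet z) W
    have h₂ : ((G.neighborSet z).ncard : ℝ) ≤ (G.neighborSet z \ W).ncard + W.ncard := by
      exact_mod_cast h₁
    have h₃ : a - w ≤ (G.neighborSet z \ W).ncard := by linarith
    refine hG.half_lt_ncard_growBall hδ hL hl hc hL2 hδl ?_ ?_ hk
    · exact hW.trans (hwc.trans (by gcongr))
    · have : (0 : ℝ) < (G.neighborSet z \ W).ncard := by linarith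
      exact_mod_cast this
  obtain ⟨z, hzx, hzy⟩ := Set.inter_nonempty_of_half_lt_ncard (hball x hx) (hball y hy)
  obtain ⟨Q, hzQ, ⟨u, huQ, hu⟩, hQW, hQ, hQk⟩ :=
    exists_connected_of_mem_growBall Set.disjoint_sdiff_left hzx
  obtain ⟨R, hzR, ⟨u', huR, hu'⟩, hRW, hR, hRk⟩ :=
    exists_connected_of_mem_growBall Set.disjoint_sdiff_left hzy
  refine ⟨Q ∪ R, ⟨u, Or.inl huQ, hu.1⟩, ⟨u', Or.inr huR, hu'.1⟩,
    Set.disjoint_union_left.2 ⟨hQW, hRW⟩,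
    SimpleGraph.induce_union_connected hQ.preconnected hR.preconnected ⟨z, hzQ, hzR⟩, ?_⟩
  have := Set.ncard_union_le Q R
  omega

/-- If any two of the vertices `v i` can be joined by connected sets of at most `K` vertices that
avoid any prescribed small set, then they are contained in disjoint connected sets of small total
size realising all adjacencies prescribed by `E`. -/
lemma exists_branchSets {V : Type*} [Finite V] {G : SimpleGraph V} {t K : ℕ} {w : ℝ}
    {v : Fin t → V} (hv : Function.Injective v)
    (hconn : ∀ W : Set V, (W.ncard : ℝ) ≤ w → ∀ i j, ∃ Q : Set V, (∃ u ∈ Q, G.Adj (v i) u) ∧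
      (∃ u ∈ Q, G.Adj (v j) u) ∧ Disjoint Q W ∧ (G.induce Q).Connected ∧ Q.ncard ≤ K)
    (E : Finset (Fin t × Fin t)) (hw : (t + E.card * K : ℝ) ≤ w) :
    ∃ P : Fin t → Set V, (∀ i, v i ∈ P i) ∧ Pairwise (Function.onFun Disjoint P) ∧
      (∀ i, (G.induce (P i)).Connected) ∧
      (∀ e ∈ E, ∃ u ∈ P e.1, ∃ u' ∈ P e.2, G.Adj u u') ∧
      (⋃ i, P i).ncard ≤ t + E.card * K := by
  induction E using Finset.induction_on with
  | empty =>
    refine ⟨fun i => {v i}, fun i => rfl, ?_, ?_, by simp, ?_⟩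
    · intro i j hij
      exact Set.disjoint_singleton.2 (hv.ne hij)
    · exact fun i => ⟨SimpleGraph.Preconnected.of_subsingleton⟩
    · rw [Set.iUnion_singleton_eq_range, ← Set.image_univ]
      simpa using Set.ncard_image_le (f := v) (Set.finite_univ)
  | insert e E heE ih =>
    rw [Finset.card_insert_of_notMem heE] at hw ⊢
    push_cast at hw
    have hK : (0 : ℝ) ≤ K := K.cast_nonneg
    obtain ⟨P, hvP, hdisj, hPc, hadj, hcard⟩ :=
      ih (by linarith)
    have hcard' : ((⋃ i, P i).ncard : ℝ) ≤ t + E.card * K := by exact_mod_cast hcard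
    obtain ⟨Q, ⟨u, huQ, hu⟩, ⟨u', huQ', hu'⟩, hQW, hQ, hQK⟩ :=
      hconn (⋃ i, P i) (by linarith) e.1 e.2
    have hQP : ∀ i, Disjoint Q (P i) := fun i =>
      hQW.mono_right (Set.subset_iUnion P i)
    have hsub : ∀ i, P i ⊆ Function.update P e.1 (P e.1 ∪ Q) i := by
      intro i
      rcases eq_or_ne i e.1 with rfl | h
      · simp
      · simp [h]
    refine ⟨Function.update P e.1 (P e.1 ∪ Q), fun i => hsub i (hvP i), ?_, ?_, ?_, ?_⟩
    · intro i j hij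
      rcases eq_or_ne i e.1 with rfl | hi
      · simp only [Function.onFun, Function.update_self, Function.update_of_ne hij.symm]
        exact Set.disjoint_union_left.2 ⟨hdisj hij, hQP j⟩
      · rcases eq_or_ne j e.1 with rfl | hj
        · simp only [Function.onFun, Function.update_self, Function.update_of_ne hij]
          exact Set.disjoint_union_right.2 ⟨hdisj hij, (hQP i).symm⟩
        · simpa only [Function.onFun, Function.update_of_ne hi, Function.update_of_ne hj]
            using hdisj hij
    · intro i
      rcases eq_or_ne i e.1 with rfl | hi
      · rw [Function.update_self]
        exact SimpleGraph.connected_induce_union (hPc _).preconnected hQ.preconnected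
          (hvP _) huQ hu
      · rw [Function.update_of_ne hi]
        exact hPc i
    · intro e' he'
      rcases Finset.mem_insert.1 he' with rfl | he'
      · refine ⟨u', ?_, v e'.2, hsub _ (hvP _), hu'.symm⟩
        rw [Function.update_self]
        exact Or.inr huQ'
      · obtain ⟨a, ha, b, hb, hab⟩ := hadj e' he'
        exact ⟨a, hsub _ ha, b, hsub _ hb, hab⟩
    · have hcover : (⋃ i, Function.update P e.1 (P e.1 ∪ Q) i) ⊆ (⋃ i, P i) ∪ Q := by
        refine Set.iUnion_subset fun i => ?_
        rcases eq_or_ne i e.1 with rfl | hi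
        · rw [Function.update_self]
          exact Set.union_subset_union_left _ (Set.subset_iUnion P _)
        · rw [Function.update_of_ne hi]
          exact (Set.subset_iUnion P i).trans Set.subset_union_left
      calc _ ≤ ((⋃ i, P i) ∪ Q).ncard := Set.ncard_le_ncard hcover
        _ ≤ (⋃ i, P i).ncard + Q.ncard := Set.ncard_union_le _ _
        _ ≤ t + E.card * K + K := by gcongr
        _ = t + (E.card + 1) * K := by ring

lemma eventually_logb_pow_le (n : ℕ) {ε : ℝ} (hε : 0 < ε) :
    ∀ᶠ L : ℝ in Filter.atTop, logb 2 L ^ n ≤ ε * L := by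
  have hlog : 0 < Real.log 2 ^ n := by positivity
  have h := (Real.isLittleO_pow_log_id_atTop (n := n)).bound (mul_pos hε hlog)
  filter_upwards [h, Filter.eventually_ge_atTop 1] with L hL hL1
  have h₀ : 0 ≤ Real.log L := Real.log_nonneg hL1
  rw [id, Real.norm_of_nonneg (by positivity), Real.norm_of_nonneg (by linarith)] at hL
  rw [logb, div_pow, div_le_iff₀ hlog]
  linarith

/-- The numerical conditions needed to route all connecting sets hold once `L` is large. -/
lemma eventually_routing_bounds {δ T : ℝ} (hδ : 0 < δ) (hT : 0 < T) :
    ∀ᶠ L : ℝ in Filter.atTop, 2 ≤ L ∧ 1 ≤ logb 2 L ∧ δ ≤ 2 * logb 2 L ^ 2 ∧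
      δ ≤ L * logb 2 L ^ 3 ∧
      T / δ * L * logb 2 L ^ 3 < L ^ 4 ∧
      T / δ * L * logb 2 L ^ 3 ≤
        δ / (2 * L * logb 2 L ^ 2) * (L ^ 4 - T / δ * L * logb 2 L ^ 3) := by
  have hlog : Filter.Tendsto (logb 2) Filter.atTop Filter.atTop :=
    Real.tendsto_logb_atTop one_lt_two
  filter_upwards [Filter.eventually_ge_atTop (2 : ℝ), Filter.eventually_ge_atTop δ,
    hlog.eventually_ge_atTop 1, hlog.eventually_ge_atTop δ,
    eventually_logb_pow_le 3 (ε := δ / (2 * T)) (by positivity),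
    eventually_logb_pow_le 5 (ε := δ ^ 2 / (4 * T)) (by positivity)]
    with L hL2 hLδ hl1 hlδ h3 h5
  set l := logb 2 L with hl
  have hsq : l ≤ l ^ 2 := by nlinarith
  have h₁ : T / δ * L * l ^ 3 ≤ L ^ 4 / 2 := by
    have : T / δ * L * l ^ 3 ≤ T / δ * L * (δ / (2 * T) * L) := by gcongr
    have h' : T / δ * L * (δ / (2 * T) * L) = L ^ 2 / 2 := by field_simp
    have h'' : L ^ 2 ≤ L ^ 4 := pow_le_pow_right₀ (by linarith) (by norm_num)
    linarith
  have hL4 : 0 < L ^ 4 := by positivity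
  refine ⟨hL2, hl1, by linarith, ?_, by linarith, ?_⟩
  · have : (1 : ℝ) ≤ l ^ 3 := one_le_pow₀ hl1
    nlinarith
  · calc T / δ * L * l ^ 3 ≤ δ / (2 * L * l ^ 2) * (L ^ 4 / 2) := by
          rw [div_mul_eq_mul_div, div_mul_eq_mul_div, div_mul_eq_mul_div,
            div_le_div_iff₀ hδ (by positivity)]
          have h₂ : T * l ^ 5 * 4 ≤ δ ^ 2 * L := by
            rw [div_mul_eq_mul_div, le_div_iff₀ (by positivity)] at h5
            linarith
          have h₃ : L ^ 3 ≤ L ^ 4 := pow_le_pow_right₀ (by linarith) (by norm_num)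
          have h₄ : L ^ 2 * (T * l ^ 5 * 4) ≤ L ^ 2 * (δ ^ 2 * L) := by gcongr
          have h₅ : δ ^ 2 * L ^ 3 ≤ δ ^ 2 * L ^ 4 := by gcongr
          linarith
      _ ≤ _ := by
          gcongr
          linarith

/-- Claim 3.6: a large `δ`-expander with `t` vertices of degree at least `(log m)⁴`
has a `K_t`-minor of order `O((t²/δ)·log m·(log log m)³)`. -/
theorem stmt_7 :
    ∃ C : ℝ, 0 < C ∧
      ∀ δ : ℝ, 0 < δ → ∀ t : ℕ, 3 ≤ t → ∃ m₀ : ℕ,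
        ∀ m : ℕ, m₀ ≤ m → ∀ G : SimpleGraph (Fin m), IsDeltaExpander G δ →
          ∀ v : Fin t → Fin m, Function.Injective v →
            (∀ i, ((G.neighborSet (v i)).ncard : ℝ) ≥ (logb 2 m) ^ 4) →
              HasKtMinorOfOrder G t
                (C * (t ^ 2 / δ) * logb 2 m * (logb 2 (logb 2 m)) ^ 3) := by
  refine ⟨21, by norm_num, fun δ hδ t ht => ?_⟩
  have hT : (0 : ℝ) < 21 * t ^ 2 := by
    have : (0 : ℝ) < t := by exact_mod_cast (by omega : 0 < t)
    positivity
  have hev := ((Real.tendsto_logb_atTop one_lt_two).comp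
    tendsto_natCast_atTop_atTop).eventually (eventually_routing_bounds hδ hT)
  obtain ⟨m₀, hm₀⟩ := Filter.eventually_atTop.1 hev
  refine ⟨m₀, fun m hm G hG v hv hdeg => ?_⟩
  obtain ⟨hL2, hl1, hδl, hδL, hwa, hwc⟩ := hm₀ m hm
  simp only [Function.comp_apply] at hL2 hl1 hδl hδL hwa hwc
  set L := logb 2 (m : ℝ) with hL
  set l := logb 2 L with hl
  obtain ⟨c, hc⟩ : ∃ c, c = δ / (2 * L * l ^ 2) := ⟨_, rfl⟩
  have hcpos : 0 < c := by rw [hc]; positivity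
  rw [← hc] at hwc
  obtain ⟨k, hkdef⟩ : ∃ k : ℕ, k = ⌊4 * Real.log L / c⌋₊ + 1 := ⟨_, rfl⟩
  have hk : 4 * Real.log L / c < k := by
    rw [hkdef]; push_cast; exact Nat.lt_floor_add_one _
  have hlog0 : 0 ≤ Real.log L := Real.log_nonneg (by linarith)
  have hk' : (k : ℝ) ≤ 8 * (L * l ^ 3 / δ) + 1 := by
    have h₁ : (⌊4 * Real.log L / c⌋₊ : ℝ) ≤ 4 * Real.log L / c :=
      Nat.floor_le (by positivity)
    have h₂ : Real.log L ≤ l := by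
      rw [hl, logb, le_div_iff₀ (Real.log_pos one_lt_two)]
      exact mul_le_of_le_one_right hlog0 (by linarith [Real.log_two_lt_d9])
    have h₃ : 4 * Real.log L / c ≤ 4 * l / c := by gcongr
    have h₄ : 4 * l / c = 8 * (L * l ^ 3 / δ) := by rw [hc]; field_simp; norm_num
    rw [hkdef]; push_cast; linarith
  have hX : 1 ≤ L * l ^ 3 / δ := (one_le_div hδ).2 hδL
  have ht1 : (1 : ℝ) ≤ t := by exact_mod_cast (by omega : 1 ≤ t)
  let E : Finset (Fin t × Fin t) := Finset.univ.filter fun e => e.1 < e.2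
  have hE : (E.card : ℝ) ≤ t ^ 2 := by
    have h : E.card ≤ t * t := by
      simpa using Finset.card_le_univ E
    rw [sq]; exact_mod_cast h
  have hbound : (t + E.card * (2 * (k + 1) : ℕ) : ℝ) ≤ 21 * t ^ 2 / δ * L * l ^ 3 := by
    have h₁ : ((2 * (k + 1) : ℕ) : ℝ) ≤ 20 * (L * l ^ 3 / δ) := by push_cast; linarith
    have h₂ : (E.card * (2 * (k + 1) : ℕ) : ℝ) ≤ t ^ 2 * (20 * (L * l ^ 3 / δ)) := by
      gcongr
    have h₃ : (t : ℝ) ≤ t ^ 2 * (L * l ^ 3 / δ) := by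
      calc (t : ℝ) ≤ t ^ 2 := by nlinarith
        _ ≤ t ^ 2 * (L * l ^ 3 / δ) := le_mul_of_one_le_right (by positivity) hX
    calc _ ≤ t ^ 2 * (L * l ^ 3 / δ) + t ^ 2 * (20 * (L * l ^ 3 / δ)) := add_le_add h₃ h₂
      _ = _ := by ring
  obtain ⟨P, hvP, hdisj, hPc, hadj, hcard⟩ := exists_branchSets hv
    (fun W hW i j => hG.exists_connector hδ (by simp [hL]) hl hc hL2 hδl hk hwa hwc
      (hdeg i) (hdeg j) hW) E hbound
  refine ⟨P, fun i => ⟨v i, hvP i⟩, hdisj, hPc, fun i j hij => hadj (i, j) (by simp [E, hij]), ?_⟩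
  calc ((⋃ i, P i).ncard : ℝ) ≤ t + E.card * (2 * (k + 1) : ℕ) := by exact_mod_cast hcard
    _ ≤ _ := hbound
    _ = _ := by ring
end

section
/- Let G be a finite nonempty simple graph on n vertices with d(G) = c. Then for every δ with 0 < δ < 1/4, G contains a subgraph G′ such that d(G′) ≥ (1−2δ)c and G′ is a (δ,n)-expander. -/
open Real

/-- The number of edges of `G` with both ends in `A`. -/
noncomputable def inducedEdgeCount {V : Type*} (G : SimpleGraph V) (A : Set V) : ℕ :=
  ((⊤ : G.Subgraph).induce A).edgeSet.ncard

lemma density_coe_induce {V : Type*} (G : SimpleGraph V) (A : Set V) :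
    density ((⊤ : G.Subgraph).induce A).coe = inducedEdgeCount G A / A.ncard := by
  have h : ((⊤ : G.Subgraph).induce A).coe.edgeSet.ncard = inducedEdgeCount G A := by
    rw [inducedEdgeCount, ← SimpleGraph.Subgraph.image_coe_edgeSet_coe]
    exact (Set.ncard_image_of_injective _ (Sym2.map.injective Subtype.val_injective)).symm
  rw [density, h]
  rfl

lemma inducedEdgeCount_univ {V : Type*} (G : SimpleGraph V) :
    inducedEdgeCount G Set.univ = G.edgeSet.ncard := by
  have h : ((⊤ : G.Subgraph).induce Set.univ).edgeSet = G.edgeSet := by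
    ext e
    induction e with
    | h a b => simp
  rw [inducedEdgeCount, h]

/-- Deleting `S` from `A` loses only edges inside `S` together with its neighborhood in `A`. -/
lemma inducedEdgeCount_le_add {V : Type*} [Finite V] (G : SimpleGraph V) {A S N : Set V}
    (hN : ∀ a ∈ S, ∀ b ∈ A, G.Adj a b → b ∈ S ∪ N) :
    inducedEdgeCount G A ≤ inducedEdgeCount G (A \ S) + inducedEdgeCount G (S ∪ N) := by
  refine le_trans (Set.ncard_le_ncard ?_ (Set.toFinite _)) (Set.ncard_union_le _ _)
  intro e
  induction e with
  | h a b =>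
    simp only [SimpleGraph.Subgraph.mem_edgeSet, SimpleGraph.Subgraph.induce_adj,
      SimpleGraph.Subgraph.top_adj, Set.mem_union, Set.mem_sdiff]
    rintro ⟨ha, hb, hab⟩
    have h₁ := fun h => hN a h b hb hab
    have h₂ := fun h => hN b h a ha hab.symm
    simp only [Set.mem_union] at h₁ h₂
    tauto

/-- The bound `2 ^ d ≤ log m / 2` encoded by the range of `d` in the definition of expanders. -/
lemma two_mul_two_pow_le_logb {m d : ℕ} (hm : 1 ≤ m)
    (hd : (d : ℝ) ≤ logb 2 (logb 2 m) - 1) : 2 * (2 : ℝ) ^ d ≤ logb 2 m := by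
  have hm' : (1 : ℝ) ≤ m := by exact_mod_cast hm
  rcases (logb_nonneg one_lt_two hm').eq_or_lt with h | h
  · rw [← h, logb_zero] at hd
    have : (0 : ℝ) ≤ d := d.cast_nonneg
    linarith
  · have h₁ : ((d + 1 : ℕ) : ℝ) ≤ logb 2 (logb 2 m) := by push_cast; linarith
    rw [le_logb_iff_rpow_le one_lt_two h, rpow_natCast, pow_succ] at h₁
    linarith

/-- A set of size at most `m / 2 ^ D` that fails to expand has a closed neighborhood whose
size is smaller than `m` by `D / 2` on the logarithmic scale. -/
lemma logb_add_le_of_le_div_two_pow {m s t : ℝ} {D : ℕ} (hm : 0 < m) (hs : 0 < s) (ht : 0 ≤ t)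
    (hD : 1 ≤ D) (hsm : s ≤ m / 2 ^ D) (hts : t ≤ s / 8) :
    logb 2 (s + t) ≤ logb 2 m - D / 2 := by
  have hD' : (1 : ℝ) ≤ D := by exact_mod_cast hD
  have hp : (0 : ℝ) < 2 ^ D := by positivity
  have h₁ : s + t ≤ 9 / 8 * (m / 2 ^ D) := by linarith
  have h₂ : logb 2 (9 / 8 : ℝ) ≤ 1 / 2 := by
    rw [logb_le_iff_le_rpow one_lt_two (by norm_num), ← sqrt_eq_rpow]
    exact le_sqrt_of_sq_le (by norm_num)
  have h₃ : logb 2 ((2 : ℝ) ^ D) = D := by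
    rw [logb_pow, logb_self_eq_one one_lt_two, mul_one]
  calc logb 2 (s + t) ≤ logb 2 (9 / 8 * (m / 2 ^ D)) :=
        logb_le_logb_of_le one_lt_two (by positivity) h₁
    _ = logb 2 (9 / 8) + (logb 2 m - D) := by
        rw [logb_mul (by norm_num) (by positivity), logb_div hm.ne' hp.ne', h₃]
    _ ≤ logb 2 m - D / 2 := by linarith

/-- The fraction of the density of an `n`-vertex graph retained on `m` vertices. -/
noncomputable def densityWeight (δ : ℝ) (n : ℕ) (m : ℝ) : ℝ :=
  1 - 2 * δ + 2 * δ * (logb 2 m / logb 2 n)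

lemma densityWeight_mono {δ : ℝ} (hδ : 0 ≤ δ) {n : ℕ} (hn : 1 ≤ n) {a b : ℝ} (ha : 0 < a)
    (hab : a ≤ b) : densityWeight δ n a ≤ densityWeight δ n b := by
  have hL : 0 ≤ logb 2 n := logb_nonneg one_lt_two (by exact_mod_cast hn)
  have := logb_le_logb_of_le one_lt_two ha hab
  unfold densityWeight
  gcongr

lemma densityWeight_self_le {δ : ℝ} (hδ : 0 ≤ δ) (n : ℕ) : densityWeight δ n n ≤ 1 := by
  have : logb 2 (n : ℝ) / logb 2 n ≤ 1 := div_self_le_one _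
  unfold densityWeight
  nlinarith

lemma le_densityWeight {δ : ℝ} (hδ : 0 ≤ δ) {n : ℕ} (hn : 1 ≤ n) {m : ℝ} (hm : 1 ≤ m) :
    1 - 2 * δ ≤ densityWeight δ n m := by
  have hL : 0 ≤ logb 2 n := logb_nonneg one_lt_two (by exact_mod_cast hn)
  have hl : 0 ≤ logb 2 m := logb_nonneg one_lt_two hm
  unfold densityWeight
  have : 0 ≤ 2 * δ * (logb 2 m / logb 2 n) := by positivity
  linarith

/-- A nonempty set `S` of `s` vertices of an `m`-vertex graph with fewer than `δ D / log n * s`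
neighbors: passing to its closed neighborhood, of size `s + t`, is affordable. -/
lemma densityWeight_mul_add_le {δ : ℝ} (hδ : 0 < δ) (hδ' : δ < 1 / 4) {n D : ℕ} {m s t : ℝ}
    (hmn : m ≤ n) (hm : 0 < m) (hs : 0 < s) (ht : 0 ≤ t) (hD : 1 ≤ D)
    (hDm : 2 * (D : ℝ) ≤ logb 2 m) (hsm : s ≤ m / 2 ^ D) (hts : t < δ * D / logb 2 n * s) :
    s + t < m ∧ densityWeight δ n (s + t) * (s + t) ≤ densityWeight δ n m * s := by
  have hD' : (1 : ℝ) ≤ D := by exact_mod_cast hD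
  have hmn' : logb 2 m ≤ logb 2 n := logb_le_logb_of_le one_lt_two hm hmn
  have hL : 0 < logb 2 n := by linarith
  have hn : 1 ≤ n := by exact_mod_cast hm.trans_le hmn
  have hx : δ * D / logb 2 n ≤ 1 / 8 := by
    rw [div_le_iff₀ hL]
    nlinarith
  have hlog := logb_add_le_of_le_div_two_pow hm hs ht hD hsm (by nlinarith)
  have hlt : s + t < m := by
    by_contra! h
    have := logb_le_logb_of_le one_lt_two hm h
    linarith
  refine ⟨hlt, ?_⟩
  have hone : densityWeight δ n (s + t) ≤ 1 :=
    (densityWeight_mono hδ.le hn (by positivity) (hlt.le.trans hmn)).trans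
      (densityWeight_self_le hδ.le n)
  have hdrop : densityWeight δ n (s + t) + δ * D / logb 2 n ≤ densityWeight δ n m := by
    have : logb 2 (s + t) / logb 2 n ≤ (logb 2 m - D / 2) / logb 2 n := by gcongr
    have h := mul_le_mul_of_nonneg_left this (by positivity : 0 ≤ 2 * δ)
    have e : 2 * δ * ((logb 2 m - D / 2) / logb 2 n)
        = 2 * δ * (logb 2 m / logb 2 n) - δ * D / logb 2 n := by ring
    unfold densityWeight
    linarith
  nlinarith

/-- If `A` is a nonempty vertex set of minimum size among those keeping a large enough
weighted density, then `A` induces an expander. -/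
lemma isDeltaNExpander_induce_of_minimal {V : Type*} [Finite V] (G : SimpleGraph V) {n : ℕ}
    (hn : Nat.card V = n) {c δ : ℝ} (hc : 0 ≤ c) (hδ : 0 < δ) (hδ' : δ < 1 / 4) {A : Set V}
    (hA : A.Nonempty)
    (hcA : c * (densityWeight δ n A.ncard * A.ncard) ≤ inducedEdgeCount G A)
    (hmin : ∀ B : Set V, B.Nonempty → B.ncard < A.ncard →
      (inducedEdgeCount G B : ℝ) < c * (densityWeight δ n B.ncard * B.ncard)) :
    IsDeltaNExpander ((⊤ : G.Subgraph).induce A).coe δ n := by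
  intro d hd (S : Set A) hS
  set N : Set A := nbhd ((⊤ : G.Subgraph).induce A).coe S
  change (d : ℝ) ≤ logb 2 (logb 2 A.ncard) - 1 at hd
  change (S.ncard : ℝ) ≤ (A.ncard : ℝ) / _ at hS
  change δ * 2 ^ d / logb 2 n * S.ncard ≤ (N.ncard : ℝ)
  by_contra! hlt
  have hA' : 0 < A.ncard := hA.ncard_pos
  have hAr : (0 : ℝ) < A.ncard := by exact_mod_cast hA'
  have hAn : (A.ncard : ℝ) ≤ n := by
    rw [← hn]
    exact_mod_cast Set.ncard_le_card A
  have hs : 0 < S.ncard := by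
    rcases Nat.eq_zero_or_pos S.ncard with h | h
    · rw [h, Nat.cast_zero, mul_zero] at hlt
      exact absurd hlt (not_lt.mpr (Nat.cast_nonneg _))
    · exact h
  have hsr : (0 : ℝ) < S.ncard := by exact_mod_cast hs
  obtain ⟨hsmall, hweight⟩ := densityWeight_mul_add_le (D := 2 ^ d) hδ hδ' hAn hAr hsr
    (Nat.cast_nonneg N.ncard) Nat.one_le_two_pow
    (by push_cast; exact two_mul_two_pow_le_logb hA' hd) hS (by push_cast; exact hlt)
  have hS' : (Subtype.val '' S).ncard = S.ncard :=
    Set.ncard_image_of_injective _ Subtype.val_injective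
  have hN' : (Subtype.val '' N).ncard = N.ncard :=
    Set.ncard_image_of_injective _ Subtype.val_injective
  have hSA : Subtype.val '' S ⊆ A := Subtype.coe_image_subset A S
  have hU : (Subtype.val '' S ∪ Subtype.val '' N).ncard = S.ncard + N.ncard := by
    rw [← Set.image_union, Set.ncard_image_of_injective _ Subtype.val_injective]
    exact Set.ncard_union_eq (Set.disjoint_left.mpr fun v hv hv' => hv'.1 hv)
  have hdiff : (A \ Subtype.val '' S).ncard + S.ncard = A.ncard := by
    rw [← hS', Set.ncard_sdiff_add_ncard_of_subset hSA]
  have hle := inducedEdgeCount_le_add G (A := A) (S := Subtype.val '' S)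
      (N := Subtype.val '' N) <| by
    rintro _ ⟨a, ha, rfl⟩ b hb hab
    by_cases hbS : (⟨b, hb⟩ : A) ∈ S
    · exact Or.inl ⟨_, hbS, rfl⟩
    · exact Or.inr ⟨⟨b, hb⟩, ⟨hbS, a, ha, a.2, hb, hab⟩, rfl⟩
  have hsA : S.ncard < A.ncard := by
    have : (0 : ℝ) ≤ N.ncard := Nat.cast_nonneg _
    exact_mod_cast (by linarith : (S.ncard : ℝ) < A.ncard)
  have h₁ := hmin (A \ Subtype.val '' S) (Set.nonempty_of_ncard_ne_zero (by omega)) (by omega)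
  have h₂ := hmin (Subtype.val '' S ∪ Subtype.val '' N)
    (Set.nonempty_of_ncard_ne_zero (by omega)) (by rw [hU]; exact_mod_cast hsmall)
  rw [hU] at h₂
  push_cast at h₂
  have hdr : ((A \ Subtype.val '' S).ncard : ℝ) = A.ncard - S.ncard := by
    rw [eq_sub_iff_add_eq]
    exact_mod_cast hdiff
  rw [hdr] at h₁
  have hsAr : (0 : ℝ) < A.ncard - S.ncard := by
    rw [sub_pos]
    exact_mod_cast hsA
  have hmono : densityWeight δ n (A.ncard - S.ncard) ≤ densityWeight δ n A.ncard :=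
    densityWeight_mono hδ.le (by exact_mod_cast hAr.trans_le hAn) hsAr (by linarith)
  have h₃ := mul_le_mul_of_nonneg_left (mul_le_mul_of_nonneg_right hmono hsAr.le) hc
  have h₄ := mul_le_mul_of_nonneg_left hweight hc
  have hle' : (inducedEdgeCount G A : ℝ) ≤ inducedEdgeCount G (A \ Subtype.val '' S)
      + inducedEdgeCount G (Subtype.val '' S ∪ Subtype.val '' N) := by exact_mod_cast hle
  linarith

/-- Lemma 4.2: every nonempty graph on `n` vertices of density `c` contains a subgraph `G'`
with `d(G') ≥ (1−2δ)c` which is a `(δ,n)`-expander. -/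
theorem stmt_9 {V : Type} [Fintype V] [Nonempty V] (G : SimpleGraph V) (n : ℕ)
    (hn : Nat.card V = n) (c : ℝ) (hc : density G = c) :
    ∀ δ : ℝ, 0 < δ → δ < 1 / 4 →
      ∃ H : G.Subgraph, density H.coe ≥ (1 - 2 * δ) * c ∧ IsDeltaNExpander H.coe δ n := by
  intro δ hδ hδ'
  have hn₁ : 1 ≤ n := hn ▸ Nat.card_pos
  have hc₀ : 0 ≤ c := by
    rw [← hc, density]
    positivity
  let good : Set (Set V) := {A | A.Nonempty ∧
    c * (densityWeight δ n A.ncard * A.ncard) ≤ inducedEdgeCount G A}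
  have huniv : Set.univ ∈ good := by
    refine ⟨Set.univ_nonempty, ?_⟩
    have hnr : (0 : ℝ) < n := by exact_mod_cast hn₁
    have hcn : c * n = G.edgeSet.ncard := by
      rw [← hc, density, hn, div_mul_cancel₀ _ hnr.ne']
    rw [Set.ncard_univ, hn, inducedEdgeCount_univ, ← hcn]
    gcongr
    exact mul_le_of_le_one_left hnr.le (densityWeight_self_le hδ.le n)
  obtain ⟨A, ⟨hA, hcA⟩, hmin⟩ :=
    Set.exists_min_image good Set.ncard (Set.toFinite _) ⟨_, huniv⟩
  have hA₁ : (1 : ℝ) ≤ A.ncard := by exact_mod_cast hA.ncard_pos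
  refine ⟨(⊤ : G.Subgraph).induce A, ?_, isDeltaNExpander_induce_of_minimal G hn hc₀ hδ hδ' hA
    hcA fun B hB hBA => lt_of_not_ge fun h => (hmin B ⟨hB, h⟩).not_gt hBA⟩
  rw [density_coe_induce, ge_iff_le, le_div_iff₀ (by positivity)]
  refine le_trans ?_ hcA
  rw [mul_comm _ c, mul_assoc]
  gcongr
  exact le_densityWeight hδ.le hn₁ hA₁
end
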